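/- For every integer n ≥ 0, in the field ℚ(q,t): Σ_{j=0}^{n} (−1)^j · t^{j(j−1)/2} · (t^{-n};t)_j · (t/q)^j / ((t;t)_j · (t^{-n+1}q^{-1};t)_j) = 1/(t^{-n+1}q^{-1};t)_n. -/

import Mathlib

/-!
Statement 4: the ₁φ₁ summation formula
  ∑_{j=0}^n (−1)^j t^{j(j−1)/2} (t^{-n};t)_j (t/q)^j / ((t;t)_j (t^{-n+1}q^{-1};t)_j)
    = 1/(t^{-n+1}q^{-1};t)_n
in the field ℚ(q,t).
-/

open Finset MvPolynomial

noncomputable section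

/-- The field ℚ(q,t): fraction field of ℚ[q,t] (variables indexed by `Bool`). -/
abbrev Fqt : Type := FractionRing (MvPolynomial Bool ℚ)

/-- The indeterminate q. -/
def qF : Fqt := algebraMap (MvPolynomial Bool ℚ) Fqt (X true)

/-- The indeterminate t. -/
def tF : Fqt := algebraMap (MvPolynomial Bool ℚ) Fqt (X false)

/-- The q-Pochhammer symbol (a;b)_n = ∏_{i=0}^{n-1} (1 - a·bⁱ). -/
def poch (a b : Fqt) (n : ℕ) : Fqt := ∏ i ∈ Finset.range n, (1 - a * b ^ i)

/-- The finite q-shifted factorial `(a;b)_n` in an arbitrary field. -/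
def qShifted {K : Type*} [Field K] (a b : K) (n : ℕ) : K := ∏ i ∈ Finset.range n, (1 - a * b ^ i)

/-- The Gaussian binomial coefficient, defined by its Pascal recursion. -/
def gaussBinom {K : Type*} [Field K] (p : K) : ℕ → ℕ → K
  | _, 0 => 1
  | 0, _ + 1 => 0
  | n + 1, k + 1 => gaussBinom p n (k + 1) + p ^ (n - k) * gaussBinom p n k

section Field

variable {K : Type*} [Field K]

theorem qShifted_zero (a b : K) : qShifted a b 0 = 1 := by
  simp [qShifted]

theorem qShifted_succ (a b : K) (n : ℕ) :
    qShifted a b (n + 1) = qShifted a b n * (1 - a * b ^ n) :=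
  Finset.prod_range_succ _ _

theorem gaussBinom_zero_right (p : K) (n : ℕ) : gaussBinom p n 0 = 1 := by
  cases n <;> rfl

theorem gaussBinom_succ_succ (p : K) (n k : ℕ) :
    gaussBinom p (n + 1) (k + 1) =
      gaussBinom p n (k + 1) + p ^ (n - k) * gaussBinom p n k := rfl

theorem gaussBinom_eq_zero_of_lt (p : K) {n k : ℕ} (h : n < k) : gaussBinom p n k = 0 := by
  induction n generalizing k with
  | zero =>
    obtain ⟨k, rfl⟩ := Nat.exists_eq_succ_of_ne_zero h.ne'
    rfl
  | succ n ih =>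
    obtain ⟨k, rfl⟩ := Nat.exists_eq_succ_of_ne_zero (Nat.ne_zero_of_lt h)
    rw [Nat.succ_eq_add_one, gaussBinom_succ_succ, ih (by omega), ih (by omega)]
    simp

theorem gaussBinom_mul_qShifted (p : K) {n k : ℕ} (h : k ≤ n) :
    gaussBinom p n k * qShifted p p k * qShifted p p (n - k) = qShifted p p n := by
  induction n generalizing k with
  | zero =>
    obtain rfl : k = 0 := by omega
    simp [gaussBinom_zero_right, qShifted_zero]
  | succ n ih =>
    cases k with
    | zero => simp [gaussBinom_zero_right, qShifted_zero]
    | succ k =>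
      rw [gaussBinom_succ_succ, Nat.add_sub_add_right]
      have hk : k ≤ n := by omega
      have h₁ := ih hk
      rcases hk.eq_or_lt with rfl | hlt
      · rw [gaussBinom_eq_zero_of_lt p (Nat.lt_succ_self k)]
        rw [Nat.sub_self] at h₁ ⊢
        rw [qShifted_succ]
        linear_combination (1 - p * p ^ k) * h₁
      · have h₂ := ih (k := k + 1) hlt
        obtain ⟨m, rfl⟩ : ∃ m, n = k + 1 + m := ⟨n - (k + 1), by omega⟩
        rw [show k + 1 + m - k = m + 1 by omega] at h₁ ⊢
        rw [Nat.add_sub_cancel_left] at h₂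
        rw [qShifted_succ p p (k + 1 + m)]
        rw [qShifted_succ p p k] at h₂ ⊢
        rw [qShifted_succ p p m] at h₁ ⊢
        linear_combination (1 - p * p ^ m) * h₂ + p ^ (m + 1) * (1 - p * p ^ k) * h₁

theorem sum_gaussBinom_mul_pow_mul_qShifted (p x : K) (n : ℕ) :
    ∑ j ∈ Finset.range (n + 1), gaussBinom p n j * x ^ j * qShifted x p (n - j) = 1 := by
  induction n with
  | zero => simp [gaussBinom_zero_right, qShifted_zero]
  | succ n ih =>
    have hshift : ∑ j ∈ Finset.range (n + 1),
          gaussBinom p n (j + 1) * x ^ (j + 1) * qShifted x p (n - j) + qShifted x p (n + 1) =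
        ∑ j ∈ Finset.range (n + 1), gaussBinom p n j * x ^ j * qShifted x p (n + 1 - j) := by
      have h := Finset.sum_range_succ'
        (fun j => gaussBinom p n j * x ^ j * qShifted x p (n + 1 - j)) (n + 1)
      rw [Finset.sum_range_succ, gaussBinom_eq_zero_of_lt p (Nat.lt_succ_self n)] at h
      simpa [gaussBinom_zero_right] using h.symm
    rw [Finset.sum_range_succ', ← ih]
    simp only [gaussBinom_succ_succ, Nat.add_sub_add_right, gaussBinom_zero_right, pow_zero,
      one_mul, Nat.sub_zero, add_mul, Finset.sum_add_distrib]
    rw [add_right_comm, hshift, ← Finset.sum_add_distrib]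
    refine Finset.sum_congr rfl fun j hj => ?_
    rw [Nat.succ_sub (Nat.lt_succ_iff.mp (Finset.mem_range.mp hj)), Nat.succ_eq_add_one,
      qShifted_succ]
    ring

theorem qShifted_mul_qShifted_inv {t : K} (ht : t ≠ 0) (x : K) {n j : ℕ} (h : j ≤ n) :
    qShifted (t ^ (1 - (n : ℤ)) * x) t j * qShifted x t⁻¹ (n - j) = qShifted x t⁻¹ n := by
  induction j with
  | zero => simp [qShifted_zero]
  | succ j ih =>
    rw [← ih (by omega), qShifted_succ, show n - j = n - (j + 1) + 1 by omega, qShifted_succ]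
    have hpow : t ^ (1 - (n : ℤ)) * t ^ j = t⁻¹ ^ (n - (j + 1)) := by
      rw [← zpow_natCast, ← zpow_natCast, inv_zpow', ← zpow_add₀ ht]
      congr 1
      omega
    rw [← hpow]
    ring

theorem qShifted_self_eq_inv {t : K} (ht : t ≠ 0) (j : ℕ) :
    qShifted t t j =
      (-1) ^ j * t ^ (j * (j - 1) / 2) * t ^ j * qShifted t⁻¹ t⁻¹ j := by
  induction j with
  | zero => simp [qShifted_zero]
  | succ j ih =>
    have hexp : (j + 1) * (j + 1 - 1) / 2 = j * (j - 1) / 2 + j := Nat.triangle_succ j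
    rw [qShifted_succ, qShifted_succ, ih, hexp, inv_pow]
    field_simp
    ring

/-- The terminating case `₁φ₁(t⁻ⁿ; t¹⁻ⁿx; t, tx)` of the `₁φ₁` summation formula. -/
theorem sum_one_phi_one {t x : K} (ht : t ≠ 0) (n : ℕ)
    (hroot : ∀ j, qShifted t t j ≠ 0) (hx : qShifted x t⁻¹ n ≠ 0) :
    ∑ j ∈ Finset.range (n + 1),
      (-1 : K) ^ j * t ^ (j * (j - 1) / 2) * qShifted (t ^ (-(n : ℤ))) t j * (t * x) ^ j /
        (qShifted t t j * qShifted (t ^ (1 - (n : ℤ)) * x) t j)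
    = (qShifted (t ^ (1 - (n : ℤ)) * x) t n)⁻¹ := by
  have hn := qShifted_mul_qShifted_inv ht x le_rfl (n := n)
  rw [Nat.sub_self, qShifted_zero, mul_one] at hn
  rw [hn, ← one_div, eq_div_iff hx, Finset.sum_mul]
  refine (Finset.sum_congr rfl fun j hj => ?_).trans
    (sum_gaussBinom_mul_pow_mul_qShifted t⁻¹ x n)
  have hjn : j ≤ n := Nat.lt_succ_iff.mp (Finset.mem_range.mp hj)
  have hxj := qShifted_mul_qShifted_inv ht x hjn
  have hden : qShifted (t ^ (1 - (n : ℤ)) * x) t j ≠ 0 := fun h => hx (by rw [← hxj, h, zero_mul])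
  have hinv : qShifted t⁻¹ t⁻¹ (n - j) ≠ 0 := fun h =>
    hroot (n - j) (by rw [qShifted_self_eq_inv ht, h, mul_zero])
  have hnum : qShifted (t ^ (-(n : ℤ))) t j = gaussBinom t⁻¹ n j * qShifted t⁻¹ t⁻¹ j := by
    apply mul_right_cancel₀ hinv
    rw [gaussBinom_mul_qShifted _ hjn, ← qShifted_mul_qShifted_inv ht t⁻¹ hjn,
      sub_eq_add_neg, zpow_add₀ ht, zpow_one, mul_right_comm, mul_inv_cancel₀ ht, one_mul]
  rw [div_mul_eq_mul_div, div_eq_iff (mul_ne_zero (hroot j) hden), hnum, ← hxj,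
    qShifted_self_eq_inv ht j, mul_pow]
  ring

end Field

theorem qF_pow_mul_tF_pow_ne_one {a b : ℕ} (h : a + b ≠ 0) : qF ^ a * tF ^ b ≠ 1 := by
  intro he
  rw [qF, tF, ← map_pow, ← map_pow, ← map_mul, ← map_one (algebraMap (MvPolynomial Bool ℚ) Fqt)]
    at he
  have h0 := congrArg (MvPolynomial.eval (0 : Bool → ℚ)) (IsFractionRing.injective _ _ he)
  rw [map_mul, map_pow, map_pow, eval_X, eval_X, map_one, Pi.zero_apply, Pi.zero_apply,
    ← pow_add, zero_pow h] at h0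
  exact zero_ne_one h0

theorem tF_ne_zero : tF ≠ 0 :=
  (map_ne_zero_iff _ (IsFractionRing.injective (MvPolynomial Bool ℚ) Fqt)).mpr (X_ne_zero _)

theorem qF_ne_zero : qF ≠ 0 :=
  (map_ne_zero_iff _ (IsFractionRing.injective (MvPolynomial Bool ℚ) Fqt)).mpr (X_ne_zero _)

theorem stmt4 (n : ℕ) :
    ∑ j ∈ Finset.range (n + 1),
      (-1 : Fqt) ^ j * tF ^ (j * (j - 1) / 2) * poch (tF ^ (-(n : ℤ))) tF j * (tF / qF) ^ j /
        (poch tF tF j * poch (tF ^ (1 - (n : ℤ)) * qF⁻¹) tF j)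
    = (poch (tF ^ (1 - (n : ℤ)) * qF⁻¹) tF n)⁻¹ := by
  simp only [div_eq_mul_inv tF]
  refine sum_one_phi_one tF_ne_zero n (fun j => ?_) ?_
  · refine Finset.prod_ne_zero_iff.mpr fun i _ h => ?_
    refine qF_pow_mul_tF_pow_ne_one (a := 0) (b := i + 1) (by omega) ?_
    rw [pow_zero, one_mul, pow_succ', ← sub_eq_zero.mp h]
  · refine Finset.prod_ne_zero_iff.mpr fun i _ h => ?_
    refine qF_pow_mul_tF_pow_ne_one (a := 1) (b := i) (by omega) ?_
    rw [pow_one, ← inv_inj, mul_inv, inv_one, ← inv_pow, ← sub_eq_zero.mp h]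

end
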